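/- There is a constant C > 0 depending only on q such that for every positive integer n and every monic polynomial f ∈ A⁺ of degree d which is not a perfect square, |Σ_{u ∈ F_n} {u/f}| ≤ C·2^{d/2}·q^{n}. -/

import Mathlib

open Polynomial UniqueFactorizationMonoid

noncomputable section

namespace EvenChar

variable {Fq : Type} [Field Fq] [Fintype Fq]

/-- Solvability of the congruence `X² + X ≡ u (mod P)` in `Fq[T]`. -/
def hasseSolvable (u : RatFunc Fq) (P : Polynomial Fq) : Prop :=
  ∃ x : Polynomial Fq, P ∣ ((x ^ 2 + x) * u.denom - u.num)

open scoped Classical in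
/-- The quadratic symbol `{u/f}` for a monic polynomial `f`. -/
def quadSym (u : RatFunc Fq) (f : Polynomial Fq) : ℤ :=
  if IsCoprime f u.denom then
    ((normalizedFactors f).map fun P => if hasseSolvable u P then (1 : ℤ) else -1).prod
  else 0

variable (Fq) in
/-- The family `F_n` of real quadratic `u`'s. -/
def Ffam (n : ℕ) : Set (RatFunc Fq) :=
  { u | ∃ (S : Finset (Polynomial Fq)) (e : Polynomial Fq → ℕ)
        (a : Polynomial Fq → ℕ → Polynomial Fq),
      (∀ P ∈ S, P.Monic ∧ Irreducible P) ∧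
      (∀ P ∈ S, 1 ≤ e P) ∧
      (∀ P ∈ S, ∀ i, 1 ≤ i → i ≤ e P → (a P i).degree < P.degree) ∧
      (∀ P ∈ S, a P (e P) ≠ 0) ∧
      (∑ P ∈ S, e P * P.natDegree) = n ∧
      u = ∑ P ∈ S, ∑ i ∈ Finset.Icc 1 (e P),
            algebraMap (Polynomial Fq) (RatFunc Fq) (a P i) /
              algebraMap (Polynomial Fq) (RatFunc Fq) P ^ (2 * i - 1) }

/-- The family `G_s` of odd polynomial parts. -/
def Gfam (ξ : Fq) (s : ℕ) : Set (Polynomial Fq) :=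
  { G | ∃ (α : Fq) (c : ℕ → Fq), (α = 0 ∨ α = ξ) ∧ c s ≠ 0 ∧
      G = C α + ∑ i ∈ Finset.Icc 1 s, C (c i) * X ^ (2 * i - 1) }

/-- The family `I_{(r,s)}`. -/
def Irs (ξ : Fq) (r s : ℕ) : Set (RatFunc Fq) :=
  { u | ∃ v ∈ Ffam Fq r, ∃ G ∈ Gfam ξ s,
      u = v + algebraMap (Polynomial Fq) (RatFunc Fq) G }

/-- The family `I_n` of ramified imaginary `u`'s. -/
def Ifam (ξ : Fq) (n : ℕ) : Set (RatFunc Fq) :=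
  ⋃ (r : ℕ) (s : ℕ) (_ : 1 ≤ s) (_ : r + s = n), Irs ξ r s

/-- The family `F'_n` of inert imaginary `u`'s. -/
def F'fam (ξ : Fq) (n : ℕ) : Set (RatFunc Fq) :=
  (fun u => u + RatFunc.C ξ) '' Ffam Fq n

/-- `A_u(n) = ∑_{f monic, deg f = n} χ_u(f)`. -/
def Acoeff (u : RatFunc Fq) (n : ℕ) : ℂ :=
  ∑' f : {f : Polynomial Fq // f.Monic ∧ f.natDegree = n}, (quadSym u f.1 : ℂ)

/-- `L(s, χ_u)` as the polynomial `∑_{n=0}^{N} A_u(n) q^{-sn}` in `q^{-s}`. -/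
def Lfun (N : ℕ) (u : RatFunc Fq) (s : ℂ) : ℂ :=
  ∑ n ∈ Finset.range (N + 1), Acoeff u n * (Fintype.card Fq : ℂ) ^ (-(s * (n : ℂ)))

/-- `ζ_A(s) = (1 - q^{1-s})⁻¹`. -/
def zetaC (q : ℕ) (s : ℂ) : ℂ := (1 - (q : ℂ) ^ ((1 : ℂ) - s))⁻¹

variable (Fq) in
/-- The Euler product `P(s) = ∏_P (1 - 1/(|P|^s (|P|+1)))`. -/
def eulerP (s : ℂ) : ℂ :=
  ∏' P : {P : Polynomial Fq // P.Monic ∧ Irreducible P},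
    (1 - (((Fintype.card Fq : ℂ) ^ (P.1.natDegree : ℂ)) ^ s *
          ((Fintype.card Fq : ℂ) ^ (P.1.natDegree : ℂ) + 1))⁻¹)

variable (Fq) in
/-- `(1/log q)·(P'/P)(1) = ∑_P deg P / (|P|(|P|+1) - 1)`. -/
def eulerPlogDeriv : ℂ :=
  ∑' P : {P : Polynomial Fq // P.Monic ∧ Irreducible P},
    (P.1.natDegree : ℂ) /
      ((Fintype.card Fq : ℂ) ^ (P.1.natDegree : ℂ) *
        ((Fintype.card Fq : ℂ) ^ (P.1.natDegree : ℂ) + 1) - 1)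

end EvenChar

section
open scoped Classical
namespace EvenChar

/-! ### Squares in characteristic two -/

lemma exists_sq_of_derivative_eq_zero {K : Type*} [Field K] [Finite K] [CharP K 2]
    (p : K[X]) (h : derivative p = 0) : ∃ r : K[X], p = r ^ 2 := by
  have : Fact (Nat.Prime 2) := ⟨Nat.prime_two⟩
  have : ExpChar K 2 := ExpChar.prime Nat.prime_two
  have h1 := expand_contract 2 h (by norm_num)
  rw [polynomial_expand_eq] at h1
  exact ⟨_, h1.symm⟩

lemma derivative_derivative_eq_zero {K : Type*} [Field K] [CharP K 2]
    (p : K[X]) : derivative (derivative p) = 0 := by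
  ext n
  rw [coeff_derivative, coeff_derivative]
  have h2 : ((n * (n + 1) : ℕ) : K) = 0 := by
    rw [CharP.cast_eq_zero_iff K 2]
    exact (Nat.even_mul_succ_self n).two_dvd
  have h3 : (2 : K) = 0 := CharTwo.two_eq_zero
  push_cast at h2 ⊢
  simp only [coeff_zero]
  linear_combination (p.coeff (n + 1 + 1)) * h2 + (p.coeff (n + 1 + 1)) * (n + 1) * h3

/-! ### The residue functional -/

/-- The residue functional: the coefficient of `T^(deg f - 1)` of `h f' mod f`. -/
def lam {K : Type*} [Field K] (f h : K[X]) : K :=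
  ((h * derivative f) %ₘ f).coeff (f.natDegree - 1)

section
variable {K : Type*} [Field K]

lemma lam_add (f h k : K[X]) : lam f (h + k) = lam f h + lam f k := by
  simp [lam, add_mul, add_modByMonic]

lemma lam_C_mul (f h : K[X]) (a : K) : lam f (C a * h) = a * lam f h := by
  simp [lam, ← smul_eq_C_mul, smul_modByMonic]

lemma lam_dvd {f h : K[X]} (hf : f.Monic) (hd : f ∣ h) : lam f h = 0 := by
  unfold lam
  rw [(modByMonic_eq_zero_iff_dvd hf).2 (hd.mul_right _)]; simp

lemma lam_congr {f h k : K[X]} (hf : f.Monic) (hd : f ∣ h - k) : lam f h = lam f k := by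
  have := lam_add f (h - k) k
  rw [lam_dvd hf hd] at this
  simpa using this

lemma lam_one (h : K[X]) : lam 1 h = 0 := by simp [lam]

lemma lam_mul_left_coeff (f g r : K[X]) (hf : f.Monic) (hg : g.Monic) (hd : r.degree < f.degree) :
    (r * g).coeff (f.natDegree + g.natDegree - 1) = r.coeff (f.natDegree - 1) := by
  by_cases h0 : f.natDegree = 0
  · have : f = 1 := hf.natDegree_eq_zero.mp h0
    subst this
    have : r = 0 := by
      rw [degree_one] at hd
      exact degree_eq_bot.mp (by simpa using hd)
    simp [this]
  · have h1 : f.natDegree + g.natDegree - 1 = (f.natDegree - 1) + g.natDegree := by omega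
    have h2 : r.natDegree ≤ f.natDegree - 1 := by
      by_cases hr : r = 0
      · simp [hr]
      · have := natDegree_lt_natDegree hr hd
        omega
    rw [h1, coeff_mul_add_eq_of_natDegree_le h2 le_rfl, hg.coeff_natDegree, mul_one]

lemma lam_mul (f g h : K[X]) (hf : f.Monic) (hg : g.Monic) :
    lam (f * g) h = lam f h + lam g h := by
  have hfg := hf.mul hg
  set r := (h * derivative f) %ₘ f with hr
  set s := (h * derivative g) %ₘ g with hs
  have hrd : r.degree < f.degree := degree_modByMonic_lt _ hf
  have hsd : s.degree < g.degree := degree_modByMonic_lt _ hg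
  have e1 := modByMonic_add_div (h * derivative f) f
  have e2 := modByMonic_add_div (h * derivative g) g
  have key := (div_modByMonic_unique ((h * derivative f) /ₘ f + (h * derivative g) /ₘ g)
    (r * g + s * f) hfg (f := h * derivative (f * g)) ⟨by
      rw [derivative_mul, hr, hs]
      linear_combination g * e1 + f * e2, by
      refine lt_of_le_of_lt (degree_add_le _ _) (max_lt ?_ ?_)
      · rw [degree_mul, degree_mul]
        exact WithBot.add_lt_add_right (by simpa using hg.ne_zero) hrd
      · rw [degree_mul, degree_mul, add_comm]
        exact WithBot.add_lt_add_left (by simpa using hf.ne_zero) hsd⟩).2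
  unfold lam
  rw [key, natDegree_mul hf.ne_zero hg.ne_zero, coeff_add, lam_mul_left_coeff f g r hf hg hrd,
    add_comm f.natDegree, lam_mul_left_coeff g f s hg hf hsd]

lemma lam_multiset_prod (s : Multiset K[X]) (hs : ∀ P ∈ s, P.Monic) (h : K[X]) :
    lam s.prod h = (s.map fun P => lam P h).sum := by
  induction s using Multiset.induction_on with
  | empty => simp [lam_one]
  | cons P s ih =>
    rw [Multiset.prod_cons, Multiset.map_cons, Multiset.sum_cons, lam_mul, ih]
    · intro Q hQ; exact hs Q (Multiset.mem_cons_of_mem hQ)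
    · exact hs P (Multiset.mem_cons_self _ _)
    · have := monic_multiset_prod_of_monic s id (fun Q hQ => hs Q (Multiset.mem_cons_of_mem hQ))
      simpa using this

lemma lam_X_sub_C (a : K) (h : K[X]) : lam (X - C a) h = h.eval a := by
  simp [lam, modByMonic_X_sub_C_eq_C_eval]

lemma lam_map {L : Type*} [Field L] (i : K →+* L) (f h : K[X]) (hf : f.Monic) :
    lam (f.map i) (h.map i) = i (lam f h) := by
  unfold lam
  rw [derivative_map, ← Polynomial.map_mul, ← map_modByMonic _ hf, coeff_map, natDegree_map]

lemma lam_sq [CharP K 2] (f h : K[X]) (hf : f.Monic) : lam f (h ^ 2) = lam f h ^ 2 := by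
  let i := algebraMap K (AlgebraicClosure K)
  have : CharP (AlgebraicClosure K) 2 := charP_of_injective_algebraMap i.injective 2
  have : Fact (Nat.Prime 2) := ⟨Nat.prime_two⟩
  have : ExpChar (AlgebraicClosure K) 2 := ExpChar.prime Nat.prime_two
  have key : ∀ k : K[X], i (lam f k) = ((f.map i).roots.map fun a => (k.map i).eval a).sum := by
    intro k
    rw [← lam_map i f k hf]
    have hs := (IsAlgClosed.splits (f.map i)).eq_prod_roots_of_monic (hf.map i)
    conv_lhs => rw [hs]
    rw [lam_multiset_prod]
    · simp [lam_X_sub_C, Multiset.map_map]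
    · intro P hP
      obtain ⟨a, -, rfl⟩ := Multiset.mem_map.mp hP
      exact monic_X_sub_C a
  apply i.injective
  have hfr := map_multiset_sum (frobenius (AlgebraicClosure K) 2)
    ((f.map i).roots.map fun a => (h.map i).eval a)
  rw [frobenius_def, Multiset.map_map] at hfr
  rw [map_pow, key, key, hfr]
  simp [frobenius_def, Function.comp_def]
end
end EvenChar

end

section
open scoped Classical
set_option linter.unusedSectionVars false
namespace EvenChar

lemma exists_tr (K : Type) [Field K] [Finite K] [CharP K 2] :
    ∃ tr : K →+ ZMod 2, (∀ x, tr (x ^ 2) = tr x) ∧ ∃ x, tr x ≠ 0 := by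
  have : Fact (Nat.Prime 2) := ⟨Nat.prime_two⟩
  let : Algebra (ZMod 2) K := ZMod.algebra K 2
  refine ⟨(Algebra.trace (ZMod 2) K).toAddMonoidHom, ?_, ?_⟩
  · intro x
    have := Algebra.trace_eq_of_algEquiv (FiniteField.frobeniusAlgEquivOfAlgebraic (ZMod 2) K) x
    simpa [ZMod.card] using this
  · by_contra! h
    apply Algebra.trace_ne_zero (ZMod 2) K
    ext x
    simpa using h x

section
variable {K : Type} [Field K] [Finite K] [CharP K 2] (tr : K →+ ZMod 2)

lemma derivative_ne_zero_of_irreducible {P : K[X]} (hP : Irreducible P) : derivative P ≠ 0 := by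
  intro h
  obtain ⟨r, hr⟩ := exists_sq_of_derivative_eq_zero P h
  rw [hr] at hP
  exact (Irreducible.not_isSquare hP) (by exact ⟨r, sq r⟩)

lemma exists_lam_ne_zero_of_derivative_ne_zero {f c : K[X]} (hf : f.Monic)
    (hc : c ≠ 0) (hcd : c.degree < f.degree) :
    ∃ a : K[X], ((a * c) %ₘ f).coeff (f.natDegree - 1) ≠ 0 := by
  have h1 := natDegree_lt_natDegree hc hcd
  refine ⟨X ^ (f.natDegree - 1 - c.natDegree), ?_⟩
  have h2 : (X ^ (f.natDegree - 1 - c.natDegree) * c).natDegree = f.natDegree - 1 := by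
    rw [natDegree_mul (pow_ne_zero _ X_ne_zero) hc, natDegree_X_pow]; omega
  have h3 : X ^ (f.natDegree - 1 - c.natDegree) * c ≠ 0 :=
    mul_ne_zero (pow_ne_zero _ X_ne_zero) hc
  rw [(modByMonic_eq_self_iff hf).2 (degree_lt_degree (by omega))]
  have h4 := leadingCoeff_ne_zero.mpr h3
  rwa [leadingCoeff, h2] at h4

lemma artin_schreier {L : Type*} [Field L] [Finite L] [CharP L 2] (Th : L →+ ZMod 2)
    (hsq : ∀ x, Th (x ^ 2) = Th x) (hTh : ∃ y, Th y ≠ 0) (y : L) (hy : Th y = 0) :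
    ∃ x, x ^ 2 + x = y := by
  let F : L →+ L :=
    { toFun := fun x => x ^ 2 + x
      map_zero' := by simp
      map_add' := fun x y => by
        rw [CharTwo.add_sq]; ring }
  have hle : F.range ≤ Th.ker := by
    rintro _ ⟨x, rfl⟩
    change Th (x ^ 2 + x) = 0
    rw [map_add, hsq]
    exact CharTwo.add_self_eq_zero _
  have hkF : Nat.card F.ker ≤ 2 := by
    have : ((F.ker : Set L)) ⊆ {0, 1} := by
      intro x hx
      have hx : x ^ 2 + x = 0 := hx
      have : x * (x + 1) = 0 := by linear_combination hx
      rcases mul_eq_zero.mp this with h | h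
      · simp [h]
      · right
        exact CharTwo.add_eq_zero.mp h
    calc Nat.card F.ker = (F.ker : Set L).ncard := rfl
      _ ≤ ({0, 1} : Set L).ncard := Set.ncard_le_ncard this (by simp)
      _ ≤ 2 := (Set.ncard_pair zero_ne_one).le
  have hrange : 2 ≤ Nat.card Th.range := by
    have : Th.range ≠ ⊥ := by
      intro hb
      obtain ⟨y, hy⟩ := hTh
      have hmem : Th y ∈ Th.range := ⟨y, rfl⟩
      rw [hb] at hmem
      exact hy hmem
    have := (AddSubgroup.one_lt_card_iff_ne_bot _).2 this
    omega
  have c1 : Nat.card F.ker * Nat.card F.range = Nat.card L := by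
    rw [← AddSubgroup.index_ker, AddSubgroup.card_mul_index]
  have c2 : Nat.card Th.ker * Nat.card Th.range = Nat.card L := by
    rw [← AddSubgroup.index_ker, AddSubgroup.card_mul_index]
  have heq : F.range = Th.ker := by
    apply AddSubgroup.eq_of_le_of_card_ge hle
    nlinarith [Nat.zero_le (Nat.card F.range), Nat.zero_le (Nat.card Th.ker)]
  have hmem : y ∈ F.range := by
    rw [heq]
    exact hy
  exact hmem

lemma solvable_iff (htr : ∀ x, tr (x ^ 2) = tr x) (htr0 : ∃ x, tr x ≠ 0)
    {P : K[X]} (hm : P.Monic) (hP : Irreducible P) (h : K[X]) :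
    (∃ x : K[X], P ∣ x ^ 2 + x - h) ↔ tr (lam P h) = 0 := by
  have hsq : ∀ x, tr (lam P (x ^ 2)) = tr (lam P x) := by
    intro x; rw [lam_sq _ _ hm, htr]
  constructor
  · rintro ⟨x, hx⟩
    rw [← lam_congr hm hx, lam_add, map_add, hsq]
    exact CharTwo.add_self_eq_zero _
  · intro h0
    have : Fact (Irreducible P) := ⟨hP⟩
    have : Module.Finite K (AdjoinRoot P) := hm.finite_adjoinRoot
    have : Finite (AdjoinRoot P) := Module.finite_of_finite K
    have : CharP (AdjoinRoot P) 2 :=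
      charP_of_injective_algebraMap (algebraMap K (AdjoinRoot P)).injective 2
    let Th : AdjoinRoot P →+ ZMod 2 :=
      { toFun := fun x => tr (lam P (AdjoinRoot.modByMonicHom hm x))
        map_zero' := by simp [lam]
        map_add' := fun x y => by rw [map_add, lam_add, map_add] }
    have hThmk : ∀ y, Th (AdjoinRoot.mk P y) = tr (lam P y) := by
      intro y
      change tr (lam P (AdjoinRoot.modByMonicHom hm (AdjoinRoot.mk P y))) = _
      rw [AdjoinRoot.modByMonicHom_mk, lam_congr hm (k := y)]
      have := modByMonic_add_div y P
      exact ⟨-(y /ₘ P), by linear_combination this⟩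
    have hThsq : ∀ x, Th (x ^ 2) = Th x := by
      intro x
      obtain ⟨y, rfl⟩ := AdjoinRoot.mk_surjective x
      rw [← map_pow, hThmk, hThmk, hsq]
    have hTh : ∃ y, Th y ≠ 0 := by
      obtain ⟨a, ha⟩ := exists_lam_ne_zero_of_derivative_ne_zero hm
        (derivative_ne_zero_of_irreducible hP) (degree_derivative_lt hP.ne_zero)
      obtain ⟨x, hx⟩ := htr0
      have ha : lam P a ≠ 0 := ha
      refine ⟨AdjoinRoot.mk P (C (x / lam P a) * a), ?_⟩
      rw [hThmk, lam_C_mul, div_mul_cancel₀ _ ha]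
      exact hx
    obtain ⟨x, hx⟩ := artin_schreier Th hThsq hTh (AdjoinRoot.mk P h) ((hThmk h).trans h0)
    obtain ⟨y, rfl⟩ := AdjoinRoot.mk_surjective x
    refine ⟨y, ?_⟩
    rw [← AdjoinRoot.mk_eq_zero, map_sub, map_add, map_pow, sub_eq_zero]
    exact hx

end

/-- The nontrivial character of `ZMod 2`. -/
def chi (z : ZMod 2) : ℤ := if z = 0 then 1 else -1

lemma chi_add (a b : ZMod 2) : chi (a + b) = chi a * chi b := by
  revert a b; decide

lemma chi_sum (s : Multiset (ZMod 2)) : chi s.sum = (s.map chi).prod := by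
  induction s using Multiset.induction_on with
  | empty => simp [chi]
  | cons a s ih => simp [chi_add, ih]

section
variable {Fq : Type} [Field Fq] [Fintype Fq]

/-- `h` represents `u` modulo `f`. -/
def Rep (f h : Fq[X]) (u : RatFunc Fq) : Prop :=
  ∃ s t : Fq[X], s ≠ 0 ∧ IsCoprime f s ∧
    algebraMap Fq[X] (RatFunc Fq) s * u = algebraMap Fq[X] (RatFunc Fq) t ∧ f ∣ h * s - t

lemma Rep.add {f h k : Fq[X]} {u v : RatFunc Fq} (hu : Rep f h u) (hv : Rep f k v) :
    Rep f (h + k) (u + v) := by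
  obtain ⟨s, t, hs, hc, e, hd⟩ := hu
  obtain ⟨s', t', hs', hc', e', hd'⟩ := hv
  refine ⟨s * s', t * s' + t' * s, mul_ne_zero hs hs', hc.mul_right hc', ?_, ?_⟩
  · simp only [map_mul, map_add]
    linear_combination (algebraMap Fq[X] (RatFunc Fq) s') * e + (algebraMap Fq[X] (RatFunc Fq) s) * e'
  · have : (h + k) * (s * s') - (t * s' + t' * s) = s' * (h * s - t) + s * (k * s' - t') := by ring
    rw [this]
    exact dvd_add (hd.mul_left _) (hd'.mul_left _)

lemma Rep.denom {f h : Fq[X]} {u : RatFunc Fq} (hu : Rep f h u) :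
    IsCoprime f u.denom ∧ f ∣ h * u.denom - u.num := by
  obtain ⟨s, t, hs, hc, e, hd⟩ := hu
  have hs' : algebraMap Fq[X] (RatFunc Fq) s ≠ 0 := by simpa using hs
  have h1 : u.denom ∣ s := by
    rw [RatFunc.denom_dvd hs]
    exact ⟨t, by rw [← e]; field_simp⟩
  refine ⟨hc.of_isCoprime_of_dvd_right h1, ?_⟩
  have hden : algebraMap Fq[X] (RatFunc Fq) u.denom ≠ 0 := by simpa using u.denom_ne_zero
  have h2 : algebraMap Fq[X] (RatFunc Fq) u.denom * u = algebraMap Fq[X] (RatFunc Fq) u.num := by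
    have := RatFunc.num_div_denom u
    rw [div_eq_iff hden] at this
    rw [this, mul_comm]
  have h3 : s * u.num = t * u.denom := by
    apply RatFunc.algebraMap_injective Fq
    rw [map_mul, map_mul, ← h2, ← e]; ring
  have h4 : f ∣ s * (h * u.denom - u.num) := by
    have : s * (h * u.denom - u.num) = (h * s - t) * u.denom := by linear_combination -h3
    rw [this]; exact hd.mul_right _
  exact hc.dvd_of_dvd_mul_left h4

lemma monic_of_mem_nf {f P : Fq[X]} (h : P ∈ normalizedFactors f) : P.Monic := by
  classical
  have h1 := normalize_normalized_factor P h
  have h2 := (irreducible_of_normalized_factor P h).ne_zero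
  rw [← h1]
  exact monic_normalize h2

lemma prod_nf {f : Fq[X]} (h : f.Monic) : (normalizedFactors f).prod = f := by
  rw [prod_normalizedFactors_eq h.ne_zero, h.normalize_eq_self]

lemma Rep.quadSym [CharP Fq 2] {tr : Fq →+ ZMod 2} (htr : ∀ x, tr (x ^ 2) = tr x)
    (htr0 : ∃ x, tr x ≠ 0) {f h : Fq[X]} {u : RatFunc Fq} (hf : f.Monic) (hu : Rep f h u) :
    quadSym u f = chi (tr (lam f h)) := by
  obtain ⟨h1, h2⟩ := hu.denom
  unfold EvenChar.quadSym
  rw [if_pos h1]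
  have h3 : lam f h = ((normalizedFactors f).map fun P => lam P h).sum := by
    conv_lhs => rw [← prod_nf hf]
    exact lam_multiset_prod _ (fun P hP => monic_of_mem_nf hP) h
  rw [h3, map_multiset_sum, Multiset.map_map, chi_sum, Multiset.map_map]
  congr 1
  apply Multiset.map_congr rfl
  intro P hP
  have hPm := monic_of_mem_nf hP
  have hPi := irreducible_of_normalized_factor P hP
  have hPf := dvd_of_mem_normalizedFactors hP
  have key : hasseSolvable u P ↔ tr (lam P h) = 0 := by
    rw [← solvable_iff tr htr htr0 hPm hPi]
    unfold hasseSolvable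
    refine exists_congr fun x => ?_
    have hcop : IsCoprime P u.denom := h1.of_isCoprime_of_dvd_left hPf
    have e : (x ^ 2 + x) * u.denom - u.num =
      u.denom * (x ^ 2 + x - h) + (h * u.denom - u.num) := by ring
    rw [e, dvd_add_left (hPf.trans h2)]
    exact ⟨hcop.dvd_of_dvd_mul_left, fun hh => hh.mul_left _⟩
  simp only [Function.comp, chi, key]

end
end EvenChar

end

section
open scoped Classical
set_option linter.unusedSectionVars false
namespace EvenChar

section
variable {Fq : Type} [Field Fq] [Fintype Fq]

lemma good_step {f P g1 p : Fq[X]} {i : ℕ} (hf : f.Monic) (hP : Irreducible P)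
    (hfd : derivative f ≠ 0) (hg : derivative f = (P ^ i * g1) ^ 2)
    (hp : f ∣ p * P ^ (2 * i + 1) - 1)
    (hgood : ∀ a : Fq[X], a.degree < P.degree → lam f (a * p) = 0) : P ∣ g1 := by
  have hf0 : f ≠ 0 := hf.ne_zero
  have hdeg : (derivative f).degree < f.degree := degree_derivative_lt hf0
  have hPi0 : P ^ i ≠ 0 := pow_ne_zero _ hP.ne_zero
  have hg10 : g1 ≠ 0 := by
    rintro rfl
    exact hfd (by simpa using hg)
  set c := (p * derivative f) %ₘ f with hc
  have hcd : c.degree < f.degree := degree_modByMonic_lt _ hf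
  have hcdvd : f ∣ p * derivative f - c := by
    have := modByMonic_add_div (p * derivative f) f
    exact ⟨(p * derivative f) /ₘ f, by rw [hc]; linear_combination -this⟩
  have hPc : f ∣ P * c - g1 ^ 2 := by
    have e : P * c - g1 ^ 2 = (p * P ^ (2 * i + 1) - 1) * g1 ^ 2 - P * (p * derivative f - c) := by
      rw [hg]; ring
    rw [e]
    exact dvd_sub (hp.mul_right _) (hcdvd.mul_left _)
  have hg1deg : (g1 ^ 2).degree < f.degree := by
    refine lt_of_le_of_lt ?_ hdeg
    rw [hg]
    exact degree_le_of_dvd ⟨(P ^ i) ^ 2, by ring⟩ (by rw [← hg]; exact hfd)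
  have hPcdeg : (P * c).degree < f.degree := by
    by_cases hc0 : c = 0
    · rw [hc0, mul_zero, degree_zero]
      exact bot_lt_iff_ne_bot.mpr (by simpa using hf0)
    by_contra! hle
    have hPcn : (P * c).natDegree = P.natDegree + c.natDegree := natDegree_mul hP.ne_zero hc0
    have h1 := natDegree_le_natDegree hle
    have h2 := natDegree_lt_natDegree hc0 hcd
    rw [hPcn] at h1
    set a : Fq[X] := X ^ (f.natDegree - 1 - c.natDegree) with ha
    have had : a.degree < P.degree := by
      apply degree_lt_degree
      rw [ha, natDegree_X_pow]; omega
    have h3 := hgood a had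
    have h4 : (a * c).natDegree = f.natDegree - 1 := by
      rw [natDegree_mul (pow_ne_zero _ X_ne_zero) hc0, natDegree_X_pow]; omega
    have h5 : (a * p * derivative f) %ₘ f = a * c := by
      have h6 : (a * c) %ₘ f = a * c :=
        (modByMonic_eq_self_iff hf).2 (degree_lt_degree (by omega))
      rw [← h6]
      have h7 : f ∣ a * p * derivative f - a * c := by
        have : a * p * derivative f - a * c = a * (p * derivative f - c) := by ring
        rw [this]; exact hcdvd.mul_left _
      have h8 := (modByMonic_eq_zero_iff_dvd hf).2 h7
      rwa [sub_modByMonic, sub_eq_zero] at h8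
    have h9 : a * c ≠ 0 := mul_ne_zero (pow_ne_zero _ X_ne_zero) hc0
    have h10 := leadingCoeff_ne_zero.mpr h9
    unfold lam at h3
    rw [h5] at h3
    rw [leadingCoeff, h4] at h10
    exact h10 h3
  have heq : P * c = g1 ^ 2 := by
    rw [← sub_eq_zero]
    exact eq_zero_of_dvd_of_degree_lt hPc
      (lt_of_le_of_lt (degree_sub_le _ _) (max_lt hPcdeg hg1deg))
  exact hP.prime.dvd_of_dvd_pow (n := 2) ⟨c, heq.symm⟩

/-! ### Parametrisation of the family -/

/-- Evaluation of partial fraction data. -/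
def Phi (c : (Σ _ : Fq[X], ℕ) →₀ Fq[X]) : RatFunc Fq :=
  c.sum fun x a => algebraMap Fq[X] (RatFunc Fq) a / algebraMap Fq[X] (RatFunc Fq) x.1 ^ (2 * x.2 - 1)

/-- Reduced data. -/
def DD (c : (Σ _ : Fq[X], ℕ) →₀ Fq[X]) : Prop :=
  ∀ x ∈ c.support, x.1.Monic ∧ Irreducible x.1 ∧ 1 ≤ x.2 ∧ (c x).degree < x.1.degree

/-- primes of the data -/
def pr (c : (Σ _ : Fq[X], ℕ) →₀ Fq[X]) : Finset Fq[X] := c.support.image Sigma.fst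

/-- exponents of the data -/
def ex (c : (Σ _ : Fq[X], ℕ) →₀ Fq[X]) (P : Fq[X]) : ℕ :=
  (c.support.filter (fun x => x.1 = P)).sup Sigma.snd

/-- the modulus of the data -/
def Mc (c : (Σ _ : Fq[X], ℕ) →₀ Fq[X]) : Fq[X] := ∏ P ∈ pr c, P ^ ex c P

lemma Phi_add (c d : (Σ _ : Fq[X], ℕ) →₀ Fq[X]) : Phi (c + d) = Phi c + Phi d := by
  unfold Phi
  rw [Finsupp.sum_add_index']
  · simp
  · intro x a b; rw [map_add, add_div]

lemma le_ex {c : (Σ _ : Fq[X], ℕ) →₀ Fq[X]} {x} (hx : x ∈ c.support) : x.2 ≤ ex c x.1 := by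
  have : x ∈ c.support.filter (fun y => y.1 = x.1) := Finset.mem_filter.mpr ⟨hx, rfl⟩
  exact Finset.le_sup (f := Sigma.snd) this

lemma ex_mem {c : (Σ _ : Fq[X], ℕ) →₀ Fq[X]} {P} (hP : P ∈ pr c) :
    (⟨P, ex c P⟩ : Σ _ : Fq[X], ℕ) ∈ c.support := by
  obtain ⟨x, hx, rfl⟩ := Finset.mem_image.mp hP
  obtain ⟨y, hy, he⟩ := Finset.exists_mem_eq_sup (c.support.filter (fun y => y.1 = x.1))
    ⟨x, Finset.mem_filter.mpr ⟨hx, rfl⟩⟩ Sigma.snd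
  obtain ⟨hy1, hy2⟩ := Finset.mem_filter.mp hy
  have : (⟨x.1, ex c x.1⟩ : Σ _ : Fq[X], ℕ) = y := by
    cases y
    simp only at hy2 he
    unfold ex
    rw [he, hy2]
  rw [this]; exact hy1

lemma DD.prime {c : (Σ _ : Fq[X], ℕ) →₀ Fq[X]} (hc : DD c) {P} (hP : P ∈ pr c) :
    P.Monic ∧ Irreducible P := by
  obtain ⟨x, hx, rfl⟩ := Finset.mem_image.mp hP
  exact ⟨(hc x hx).1, (hc x hx).2.1⟩

lemma coprime_of_ne {P Q : Fq[X]} (hP : P.Monic ∧ Irreducible P) (hQ : Q.Monic ∧ Irreducible Q)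
    (h : P ≠ Q) : IsCoprime P Q := by
  rw [hP.2.coprime_iff_not_dvd]
  intro hd
  exact h (eq_of_monic_of_associated hP.1 hQ.1 (hP.2.associated_of_dvd hQ.2 hd))

lemma Mc_dvd_iff {c : (Σ _ : Fq[X], ℕ) →₀ Fq[X]} (hc : DD c) (M : Fq[X]) :
    Mc c ∣ M ↔ ∀ x ∈ c.support, x.1 ^ x.2 ∣ M := by
  constructor
  · intro h x hx
    have h1 : x.1 ^ ex c x.1 ∣ Mc c := Finset.dvd_prod_of_mem (fun P => P ^ ex c P)
      (Finset.mem_image_of_mem _ hx)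
    exact ((pow_dvd_pow _ (le_ex hx)).trans h1).trans h
  · intro h
    have hcop : ∀ P ∈ pr c, ∀ Q ∈ pr c, P ≠ Q → IsCoprime (P ^ ex c P) (Q ^ ex c Q) := by
      intro P hP Q hQ hne
      exact IsCoprime.pow (coprime_of_ne (hc.prime hP) (hc.prime hQ) hne)
    unfold Mc
    refine Finset.prod_dvd_of_coprime (fun P hP Q hQ hne => ?_) ?_
    · exact hcop P hP Q hQ hne
    · intro P hP
      exact h ⟨P, ex c P⟩ (ex_mem hP)

lemma Mc_monic {c : (Σ _ : Fq[X], ℕ) →₀ Fq[X]} (hc : DD c) : (Mc c).Monic :=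
  monic_prod_of_monic _ _ fun _ hP => (hc.prime hP).1.pow _

lemma Mc_natDegree {c : (Σ _ : Fq[X], ℕ) →₀ Fq[X]} (hc : DD c) :
    (Mc c).natDegree = ∑ P ∈ pr c, ex c P * P.natDegree := by
  unfold Mc
  rw [natDegree_prod_of_monic _ _ fun _ hP => (hc.prime hP).1.pow _]
  simp

lemma Ffam_eq (n : ℕ) : Ffam Fq n = Phi '' {c | DD c ∧ (Mc c).natDegree = n} := by
  ext u
  constructor
  · rintro ⟨S, e, a, hS, he, ha, hae, hn, hu⟩
    let I : Finset (Σ _ : Fq[X], ℕ) := S.sigma fun P => Finset.Icc 1 (e P)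
    let c : (Σ _ : Fq[X], ℕ) →₀ Fq[X] := Finsupp.onFinset I
      (fun x => if x ∈ I then a x.1 x.2 else 0) (by intro x hx; by_contra h; simp [h] at hx)
    have hcI : ∀ x ∈ I, c x = a x.1 x.2 := by
      intro x hx
      simp [c, hx]
    have hsub : c.support ⊆ I := Finsupp.support_onFinset_subset
    have hmem : ∀ x ∈ I, x.1 ∈ S ∧ 1 ≤ x.2 ∧ x.2 ≤ e x.1 := by
      intro x hx
      simpa [I] using hx
    have hc : DD c := by
      intro x hx
      have hxI := hsub hx
      obtain ⟨h1, h2, h3⟩ := hmem x hxI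
      refine ⟨(hS _ h1).1, (hS _ h1).2, h2, ?_⟩
      rw [hcI x hxI]
      exact ha _ h1 _ h2 h3
    have htop : ∀ P ∈ S, (⟨P, e P⟩ : Σ _ : Fq[X], ℕ) ∈ c.support := by
      intro P hP
      have : (⟨P, e P⟩ : Σ _ : Fq[X], ℕ) ∈ I := by simpa [I] using ⟨hP, he P hP⟩
      rw [Finsupp.mem_support_iff, hcI _ this]
      exact hae P hP
    have hpr : pr c = S := by
      apply Finset.Subset.antisymm
      · intro P hP
        obtain ⟨x, hx, rfl⟩ := Finset.mem_image.mp hP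
        exact (hmem x (hsub hx)).1
      · intro P hP
        exact Finset.mem_image.mpr ⟨_, htop P hP, rfl⟩
    have hex : ∀ P ∈ S, ex c P = e P := by
      intro P hP
      apply le_antisymm
      · apply Finset.sup_le
        intro x hx
        obtain ⟨hx1, rfl⟩ := Finset.mem_filter.mp hx
        exact (hmem x (hsub hx1)).2.2
      · exact le_ex (htop P hP)
    refine ⟨c, ⟨hc, ?_⟩, ?_⟩
    · rw [Mc_natDegree hc, hpr, ← hn]
      exact Finset.sum_congr rfl fun P hP => by rw [hex P hP]
    · rw [hu]
      unfold Phi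
      rw [Finsupp.sum_of_support_subset _ hsub _ (by simp), Finset.sum_sigma]
      refine Finset.sum_congr rfl fun P hP => Finset.sum_congr rfl fun i hi => ?_
      rw [hcI ⟨P, i⟩ (Finset.mem_sigma.mpr ⟨hP, hi⟩)]
  · rintro ⟨c, ⟨hc, hn⟩, rfl⟩
    refine ⟨pr c, ex c, fun P i => c ⟨P, i⟩, fun P hP => hc.prime hP, ?_, ?_, ?_, ?_, ?_⟩
    · intro P hP
      exact (hc _ (ex_mem hP)).2.2.1
    · intro P hP i _ _
      by_cases h : (⟨P, i⟩ : Σ _ : Fq[X], ℕ) ∈ c.support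
      · exact (hc _ h).2.2.2
      · change (c ⟨P, i⟩).degree < _
        rw [Finsupp.notMem_support_iff.mp h, degree_zero]
        exact bot_lt_iff_ne_bot.mpr (by simpa using (hc.prime hP).1.ne_zero)
    · intro P hP
      exact Finsupp.mem_support_iff.mp (ex_mem hP)
    · rw [← Mc_natDegree hc, hn]
    · unfold Phi
      rw [Finsupp.sum_of_support_subset (s := (pr c).sigma fun P => Finset.Icc 1 (ex c P)) _ _ _
        (by simp), Finset.sum_sigma]
      intro x hx
      rw [Finset.mem_sigma, Finset.mem_Icc]
      exact ⟨Finset.mem_image_of_mem _ hx, (hc x hx).2.2.1, le_ex hx⟩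

/-! ### Denominators -/

/-- The maximal ideal of the localisation at `P`. -/
def maxId (P : Fq[X]) (hP : Irreducible P) : AddSubgroup (RatFunc Fq) where
  carrier := {u | ∃ s t : Fq[X], ¬ P ∣ s ∧
    algebraMap Fq[X] (RatFunc Fq) s * u = algebraMap Fq[X] (RatFunc Fq) (P * t)}
  zero_mem' := ⟨1, 0, fun h => hP.not_isUnit (isUnit_of_dvd_one h), by simp⟩
  add_mem' := by
    rintro u v ⟨s, t, hs, e⟩ ⟨s', t', hs', e'⟩
    refine ⟨s * s', t * s' + t' * s, ?_, ?_⟩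
    · intro h; rcases hP.prime.dvd_or_dvd h with h | h
      · exact hs h
      · exact hs' h
    · simp only [map_mul, map_add] at e e' ⊢
      linear_combination (algebraMap Fq[X] (RatFunc Fq) s') * e +
        (algebraMap Fq[X] (RatFunc Fq) s) * e'
  neg_mem' := by
    rintro u ⟨s, t, hs, e⟩
    refine ⟨s, -t, hs, ?_⟩
    rw [mul_neg, e]; simp

lemma dvd_denom {c : (Σ _ : Fq[X], ℕ) →₀ Fq[X]} (hc : DD c) {P} (hP : P ∈ pr c) :
    P ∣ (Phi c).denom := by
  by_contra hnd
  obtain ⟨hPm, hPi⟩ := hc.prime hP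
  set e := ex c P with he
  set x0 : Σ _ : Fq[X], ℕ := ⟨P, e⟩ with hx0
  have hx0s : x0 ∈ c.support := ex_mem hP
  have he1 : 1 ≤ e := (hc _ hx0s).2.2.1
  set i := algebraMap Fq[X] (RatFunc Fq) with hi
  have hP0 : i P ≠ 0 := by simpa [hi] using hPi.ne_zero
  have hmem : i P ^ (2 * e - 1) * Phi c ∈ maxId P hPi := by
    refine ⟨(Phi c).denom, P ^ (2 * e - 2) * (Phi c).num, hnd, ?_⟩
    have hden : i (Phi c).denom ≠ 0 := by simpa [hi] using (Phi c).denom_ne_zero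
    have h1 := RatFunc.num_div_denom (Phi c)
    rw [div_eq_iff hden] at h1
    change i _ * _ = i _
    rw [map_mul, map_mul, map_pow, h1]
    have : 2 * e - 1 = (2 * e - 2) + 1 := by omega
    rw [this, pow_succ]; ring
  have hrest : ∀ x ∈ c.support.erase x0,
      i P ^ (2 * e - 1) * (i (c x) / i x.1 ^ (2 * x.2 - 1)) ∈ maxId P hPi := by
    intro x hx
    obtain ⟨hne, hxs⟩ := Finset.mem_erase.mp hx
    obtain ⟨h1, h2, h3, h4⟩ := hc x hxs
    have hx10 : i x.1 ≠ 0 := by simpa [hi] using h2.ne_zero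
    by_cases hxP : x.1 = P
    · have hlt : x.2 < e := by
        have hle := le_ex hxs
        rw [hxP] at hle
        refine lt_of_le_of_ne hle fun h => hne ?_
        cases x
        simp only at hxP h
        rw [hx0, hxP, h]
      refine ⟨1, P ^ (2 * e - 2 * x.2 - 1) * c x, fun h => hPi.not_isUnit (isUnit_of_dvd_one h), ?_⟩
      change i 1 * _ = i _
      rw [hxP, map_one, one_mul, map_mul, map_mul, map_pow]
      have : 2 * e - 1 = (2 * e - 2 * x.2 - 1) + 1 + (2 * x.2 - 1) := by omega
      rw [this, pow_add, pow_succ]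
      field_simp
    · refine ⟨x.1 ^ (2 * x.2 - 1), P ^ (2 * e - 2) * c x, ?_, ?_⟩
      · intro h
        have h := hPi.prime.dvd_of_dvd_pow h
        exact ((hPi.coprime_iff_not_dvd).1 (coprime_of_ne ⟨hPm, hPi⟩ ⟨h1, h2⟩ (Ne.symm hxP))) h
      · change i _ * _ = i _
        rw [map_mul, map_mul, map_pow, map_pow]
        have : 2 * e - 1 = (2 * e - 2) + 1 := by omega
        rw [this, pow_succ]
        field_simp
  have hsum : Phi c = i (c x0) / i P ^ (2 * e - 1) +
      ∑ x ∈ c.support.erase x0, i (c x) / i x.1 ^ (2 * x.2 - 1) := by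
    unfold Phi Finsupp.sum
    rw [← Finset.add_sum_erase _ _ hx0s]
  have hfin : i (c x0) ∈ maxId P hPi := by
    have e1 : i (c x0) = i P ^ (2 * e - 1) * Phi c -
      ∑ x ∈ c.support.erase x0, i P ^ (2 * e - 1) * (i (c x) / i x.1 ^ (2 * x.2 - 1)) := by
      rw [hsum, mul_add, Finset.mul_sum, add_sub_cancel_right]
      field_simp
    rw [e1]
    exact sub_mem hmem (sum_mem hrest)
  obtain ⟨s, t, hs, hst⟩ := hfin
  have hst : s * c x0 = P * t := RatFunc.algebraMap_injective Fq (by rw [map_mul]; exact hst)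
  rcases hPi.prime.dvd_or_dvd ⟨t, hst⟩ with h | h
  · exact hs h
  · exact Finsupp.mem_support_iff.mp hx0s (eq_zero_of_dvd_of_degree_lt h (hc _ hx0s).2.2.2)

lemma DD.add {c d : (Σ _ : Fq[X], ℕ) →₀ Fq[X]} (hc : DD c) (hd : DD d) : DD (c + d) := by
  intro x hx
  have h := Finsupp.support_add hx
  have key : ∀ {c : (Σ _ : Fq[X], ℕ) →₀ Fq[X]}, DD c → Irreducible x.1 →
      (c x).degree < x.1.degree := by
    intro c hc hi
    by_cases h : x ∈ c.support
    · exact (hc _ h).2.2.2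
    · rw [Finsupp.notMem_support_iff.mp h, degree_zero]
      exact bot_lt_iff_ne_bot.mpr (by simpa using hi.ne_zero)
  have h' : x.1.Monic ∧ Irreducible x.1 ∧ 1 ≤ x.2 := by
    rcases Finset.mem_union.mp h with h | h
    · exact ⟨(hc x h).1, (hc x h).2.1, (hc x h).2.2.1⟩
    · exact ⟨(hd x h).1, (hd x h).2.1, (hd x h).2.2.1⟩
  refine ⟨h'.1, h'.2.1, h'.2.2, ?_⟩
  rw [Finsupp.add_apply]
  exact lt_of_le_of_lt (degree_add_le _ _) (max_lt (key hc h'.2.1) (key hd h'.2.1))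

lemma Phi_neg (c : (Σ _ : Fq[X], ℕ) →₀ Fq[X]) : Phi (-c) = -Phi c := by
  have h := Phi_add c (-c)
  rw [add_neg_cancel] at h
  have h0 : Phi (0 : (Σ _ : Fq[X], ℕ) →₀ Fq[X]) = 0 := by simp [Phi]
  rw [h0] at h
  exact (neg_eq_of_add_eq_zero_right h.symm).symm

lemma DD.neg {c : (Σ _ : Fq[X], ℕ) →₀ Fq[X]} (hc : DD c) : DD (-c) := by
  intro x hx
  rw [Finsupp.support_neg] at hx
  simpa using hc x hx

lemma Phi_injOn : Set.InjOn (Phi (Fq := Fq)) {c | DD c} := by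
  intro c hc d hd h
  have h1 : DD (c + -d) := DD.add hc (DD.neg hd)
  have h2 : Phi (c + -d) = 0 := by rw [Phi_add, Phi_neg, h, add_neg_cancel]
  by_contra hne
  have h3 : c + -d ≠ 0 := by
    rw [← sub_eq_add_neg]; exact sub_ne_zero.mpr hne
  obtain ⟨x, hx⟩ := Finsupp.support_nonempty_iff.mpr h3
  have h4 := dvd_denom h1 (Finset.mem_image_of_mem Sigma.fst hx)
  rw [h2, RatFunc.denom_zero] at h4
  exact (h1 x hx).2.1.not_isUnit (isUnit_of_dvd_one h4)

end
end EvenChar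

end

section
open scoped Classical
set_option linter.unusedSectionVars false
namespace EvenChar

section
variable {Fq : Type} [Field Fq] [Fintype Fq]

/-! ### Finite sets of polynomials -/

lemma finite_degreeLT (n : ℕ) : Finite (degreeLT Fq n) :=
  Finite.of_equiv _ (degreeLTEquiv Fq n).symm.toEquiv

/-- polynomials of degree less than `n` -/
def Lt (Fq : Type) [Field Fq] [Fintype Fq] (n : ℕ) : Finset Fq[X] :=
  (show (degreeLT Fq n : Set Fq[X]).Finite from finite_degreeLT n).toFinset

lemma mem_Lt {n : ℕ} {p : Fq[X]} : p ∈ Lt Fq n ↔ p.degree < n := by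
  simp [Lt, mem_degreeLT]

lemma card_Lt (n : ℕ) : (Lt Fq n).card = Fintype.card Fq ^ n := by
  unfold Lt
  rw [← Set.ncard_eq_toFinset_card (degreeLT Fq n : Set Fq[X]) (finite_degreeLT n),
    ← Nat.card_coe_set_eq]
  change Nat.card (degreeLT Fq n) = _
  rw [Nat.card_congr (degreeLTEquiv Fq n).toEquiv]
  simp

/-- monic polynomials of degree `n` -/
def Mon (Fq : Type) [Field Fq] [Fintype Fq] (n : ℕ) : Finset Fq[X] :=
  (Lt Fq n).image fun r => X ^ n + r

lemma mem_Mon {n : ℕ} {p : Fq[X]} : p ∈ Mon Fq n ↔ p.Monic ∧ p.natDegree = n := by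
  unfold Mon
  rw [Finset.mem_image]
  constructor
  · rintro ⟨r, hr, rfl⟩
    rw [mem_Lt] at hr
    exact ⟨monic_X_pow_add hr, natDegree_eq_of_degree_eq_some
      (by rw [degree_add_eq_left_of_degree_lt (by rwa [degree_X_pow]), degree_X_pow])⟩
  · rintro ⟨hm, rfl⟩
    refine ⟨p - X ^ p.natDegree, ?_, by ring⟩
    rw [mem_Lt, ← degree_eq_natDegree hm.ne_zero]
    apply degree_sub_lt_left _ hm.ne_zero
    · simp [hm.leadingCoeff]
    · rw [degree_X_pow, degree_eq_natDegree hm.ne_zero]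

lemma card_Mon (n : ℕ) : (Mon Fq n).card = Fintype.card Fq ^ n := by
  unfold Mon
  rw [Finset.card_image_of_injective _ (add_right_injective _), card_Lt]

lemma card_Mon_dvd {M₀ : Fq[X]} (h0 : M₀.Monic) (n : ℕ) :
    ((Mon Fq n).filter fun M => M₀ ∣ M).card =
      if M₀.natDegree ≤ n then Fintype.card Fq ^ (n - M₀.natDegree) else 0 := by
  split_ifs with h
  · rw [← card_Mon (Fq := Fq) (n - M₀.natDegree)]
    symm
    apply Finset.card_bij (fun K _ => M₀ * K)
    · intro K hK
      rw [mem_Mon] at hK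
      rw [Finset.mem_filter, mem_Mon]
      refine ⟨⟨h0.mul hK.1, ?_⟩, dvd_mul_right _ _⟩
      rw [h0.natDegree_mul hK.1, hK.2]; omega
    · intro K _ K' _ he
      exact mul_left_cancel₀ h0.ne_zero he
    · intro M hM
      rw [Finset.mem_filter, mem_Mon] at hM
      obtain ⟨⟨hm, hd⟩, K, rfl⟩ := hM
      have hK : K.Monic := h0.of_mul_monic_left hm
      refine ⟨K, ?_, rfl⟩
      rw [mem_Mon]
      refine ⟨hK, ?_⟩
      rw [h0.natDegree_mul hK] at hd; omega
  · rw [Finset.card_eq_zero, Finset.filter_eq_empty_iff]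
    intro M hM hd
    rw [mem_Mon] at hM
    have := natDegree_le_of_dvd hd hM.1.ne_zero
    omega

/-! ### Factorisations -/

lemma pow_dvd_iff_le_count {P M : Fq[X]} (hP : P.Monic) (hi : Irreducible P) (hM : M ≠ 0) (i : ℕ) :
    P ^ i ∣ M ↔ i ≤ (normalizedFactors M).count P := by
  rw [pow_dvd_iff_le_emultiplicity, emultiplicity_eq_count_normalizedFactors hi hM,
    hP.normalize_eq_self]
  simp

lemma mem_nf_iff {P M : Fq[X]} (hM : M ≠ 0) :
    P ∈ normalizedFactors M ↔ P.Monic ∧ Irreducible P ∧ P ∣ M := by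
  constructor
  · intro h
    exact ⟨monic_of_mem_nf h, irreducible_of_normalized_factor P h, dvd_of_mem_normalizedFactors h⟩
  · rintro ⟨h1, h2, h3⟩
    have := (pow_dvd_iff_le_count h1 h2 hM 1).1 (by simpa using h3)
    exact Multiset.count_pos.mp this

lemma natDegree_eq_sum {M : Fq[X]} (hM : M.Monic) (s : Finset Fq[X])
    (hs : (normalizedFactors M).toFinset ⊆ s) :
    M.natDegree = ∑ P ∈ s, (normalizedFactors M).count P * P.natDegree := by
  conv_lhs => rw [← prod_nf hM]
  rw [natDegree_multiset_prod_of_monic _ (fun P hP => monic_of_mem_nf hP),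
    Finset.sum_multiset_map_count]
  simp only [smul_eq_mul]
  refine Finset.sum_subset hs ?_
  intro P _ hP
  rw [Multiset.mem_toFinset] at hP
  simp [Multiset.count_eq_zero_of_notMem hP]

lemma eq_prod_count {M : Fq[X]} (hM : M.Monic) (s : Finset Fq[X])
    (hs : (normalizedFactors M).toFinset ⊆ s) :
    M = ∏ P ∈ s, P ^ (normalizedFactors M).count P := by
  conv_lhs => rw [← prod_nf hM]
  rw [Finset.prod_multiset_count]
  refine Finset.prod_subset hs ?_
  intro P _ hP
  rw [Multiset.mem_toFinset] at hP
  simp [Multiset.count_eq_zero_of_notMem hP]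

lemma dvd_of_pow_dvd {M g : Fq[X]} (hM : M.Monic)
    (h : ∀ P : Fq[X], P.Monic → Irreducible P → ∀ i, P ^ i ∣ M → P ^ i ∣ g) : M ∣ g := by
  by_cases hg : g = 0
  · simp [hg]
  rw [dvd_iff_normalizedFactors_le_normalizedFactors hM.ne_zero hg, Multiset.le_iff_count]
  intro P
  by_cases hP : P ∈ normalizedFactors M
  · obtain ⟨h1, h2, h3⟩ := (mem_nf_iff hM.ne_zero).1 hP
    rw [← pow_dvd_iff_le_count h1 h2 hg]
    exact h P h1 h2 _ ((pow_dvd_iff_le_count h1 h2 hM.ne_zero _).2 le_rfl)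
  · simp [Multiset.count_eq_zero_of_notMem hP]

lemma mem_of_dvd_prod {s : Multiset Fq[X]} (hs : ∀ Q ∈ s, Q.Monic ∧ Irreducible Q) {P : Fq[X]}
    (hP : P.Monic) (hi : Irreducible P) (hd : P ∣ s.prod) : P ∈ s := by
  obtain ⟨Q, hQ, hPQ⟩ := hi.prime.exists_mem_multiset_dvd hd
  have := eq_of_monic_of_associated hP (hs Q hQ).1 (hi.associated_of_dvd (hs Q hQ).2 hPQ)
  rwa [this]

lemma exists_decomp (f : Fq[X]) {M : Fq[X]} (hM : M.Monic) :
    ∃ N B : Fq[X], N.Monic ∧ B.Monic ∧ M = N * B ∧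
      (∀ P : Fq[X], P.Monic → Irreducible P → P ∣ N → ¬ P ∣ f) ∧
      (∀ P : Fq[X], P.Monic → Irreducible P → P ∣ B → P ∣ f) := by
  set s := normalizedFactors M with hs
  have h1 : ∀ Q ∈ s, Q.Monic ∧ Irreducible Q := fun Q hQ =>
    ⟨monic_of_mem_nf hQ, irreducible_of_normalized_factor Q hQ⟩
  have hmon : ∀ t : Multiset Fq[X], t ≤ s → t.prod.Monic := by
    intro t ht
    have := monic_multiset_prod_of_monic t id (fun Q hQ => (h1 Q (Multiset.mem_of_le ht hQ)).1)
    simpa using this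
  refine ⟨(s.filter fun P => ¬ P ∣ f).prod, (s.filter fun P => P ∣ f).prod,
    hmon _ (Multiset.filter_le _ _), hmon _ (Multiset.filter_le _ _), ?_, ?_, ?_⟩
  · rw [mul_comm, ← Multiset.prod_add, Multiset.filter_add_not, hs, prod_nf hM]
  · intro P hP hi hd
    have := mem_of_dvd_prod (fun Q hQ => h1 Q (Multiset.mem_of_mem_filter hQ)) hP hi hd
    exact (Multiset.mem_filter.mp this).2
  · intro P hP hi hd
    have := mem_of_dvd_prod (fun Q hQ => h1 Q (Multiset.mem_of_mem_filter hQ)) hP hi hd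
    exact (Multiset.mem_filter.mp this).2

/-! ### Data supported on divisors of `M` -/

/-- index set -/
def Ix (M : Fq[X]) : Finset (Σ _ : Fq[X], ℕ) :=
  (normalizedFactors M).toFinset.sigma fun P => Finset.Icc 1 ((normalizedFactors M).count P)

lemma mem_Ix {M : Fq[X]} (hM : M ≠ 0) (x : Σ _ : Fq[X], ℕ) :
    x ∈ Ix M ↔ x.1.Monic ∧ Irreducible x.1 ∧ 1 ≤ x.2 ∧ x.1 ^ x.2 ∣ M := by
  unfold Ix
  rw [Finset.mem_sigma, Multiset.mem_toFinset, Finset.mem_Icc, mem_nf_iff hM]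
  constructor
  · rintro ⟨⟨h1, h2, h3⟩, h4, h5⟩
    exact ⟨h1, h2, h4, (pow_dvd_iff_le_count h1 h2 hM _).2 h5⟩
  · rintro ⟨h1, h2, h3, h4⟩
    exact ⟨⟨h1, h2, (dvd_pow_self _ (by omega)).trans h4⟩, h3,
      (pow_dvd_iff_le_count h1 h2 hM _).1 h4⟩

/-- the data with modulus dividing `M` -/
def Dfin (M : Fq[X]) : Finset ((Σ _ : Fq[X], ℕ) →₀ Fq[X]) :=
  (Ix M).finsupp fun x => Lt Fq x.1.natDegree

lemma mem_Dfin {M : Fq[X]} (hM : M ≠ 0) (c : (Σ _ : Fq[X], ℕ) →₀ Fq[X]) :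
    c ∈ Dfin M ↔ DD c ∧ Mc c ∣ M := by
  unfold Dfin
  rw [Finset.mem_finsupp_iff]
  constructor
  · rintro ⟨h1, h2⟩
    have hc : DD c := by
      intro x hx
      obtain ⟨a1, a2, a3, a4⟩ := (mem_Ix hM x).1 (h1 hx)
      refine ⟨a1, a2, a3, ?_⟩
      have := h2 x (h1 hx)
      rwa [mem_Lt, ← degree_eq_natDegree a1.ne_zero] at this
    refine ⟨hc, ?_⟩
    rw [Mc_dvd_iff hc]
    intro x hx
    exact ((mem_Ix hM x).1 (h1 hx)).2.2.2
  · rintro ⟨hc, hd⟩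
    rw [Mc_dvd_iff hc] at hd
    refine ⟨?_, ?_⟩
    · intro x hx
      rw [mem_Ix hM]
      exact ⟨(hc x hx).1, (hc x hx).2.1, (hc x hx).2.2.1, hd x hx⟩
    · intro x hx
      rw [mem_Lt]
      by_cases h : x ∈ c.support
      · rw [← degree_eq_natDegree (hc x h).1.ne_zero]
        exact (hc x h).2.2.2
      · rw [Finsupp.notMem_support_iff.mp h, degree_zero]
        exact WithBot.bot_lt_coe _

lemma card_Dfin {M : Fq[X]} (hM : M.Monic) : (Dfin M).card = Fintype.card Fq ^ M.natDegree := by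
  unfold Dfin
  rw [Finset.card_finsupp]
  simp only [card_Lt]
  unfold Ix
  rw [Finset.prod_sigma, natDegree_eq_sum hM _ (Finset.Subset.refl _), ← Finset.prod_pow_eq_pow_sum]
  refine Finset.prod_congr rfl fun P _ => ?_
  simp [mul_comm, pow_mul]

/-! ### Character sums -/

lemma Rep.zero (f : Fq[X]) : Rep f 0 (0 : RatFunc Fq) :=
  ⟨1, 0, one_ne_zero, isCoprime_one_right, by simp, by simp⟩

lemma Rep.div {f p Q : Fq[X]} (a : Fq[X]) (hQ : Q ≠ 0) (h : f ∣ p * Q - 1) :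
    Rep f (a * p) (algebraMap Fq[X] (RatFunc Fq) a / algebraMap Fq[X] (RatFunc Fq) Q) := by
  have hQ' : algebraMap Fq[X] (RatFunc Fq) Q ≠ 0 := by simpa using hQ
  refine ⟨Q, a, hQ, ?_, ?_, ?_⟩
  · obtain ⟨k, hk⟩ := h
    exact ⟨-k, p, by linear_combination hk⟩
  · field_simp
  · have : a * p * Q - a = a * (p * Q - 1) := by ring
    rw [this]; exact h.mul_left _

lemma exists_inv {f P : Fq[X]} (hP : Irreducible P) (h : ¬ P ∣ f) (k : ℕ) :
    ∃ p, f ∣ p * P ^ k - 1 := by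
  have : IsCoprime f (P ^ k) := ((hP.coprime_iff_not_dvd).2 h).symm.pow_right
  obtain ⟨a, b, hab⟩ := this
  exact ⟨b, -a, by linear_combination hab⟩

lemma exists_rep {f : Fq[X]} {c : (Σ _ : Fq[X], ℕ) →₀ Fq[X]} (hc : DD c)
    (h : ∀ P ∈ pr c, ¬ P ∣ f) : ∃ k, Rep f k (Phi c) := by
  unfold Phi Finsupp.sum
  refine Finset.sum_induction _ (fun u => ∃ k, Rep f k u) ?_ ⟨0, Rep.zero f⟩ ?_
  · rintro u v ⟨k, hk⟩ ⟨l, hl⟩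
    exact ⟨k + l, hk.add hl⟩
  · intro x hx
    obtain ⟨p, hp⟩ := exists_inv (hc x hx).2.1 (h _ (Finset.mem_image_of_mem _ hx)) (2 * x.2 - 1)
    change ∃ k, Rep f k (algebraMap Fq[X] (RatFunc Fq) (c x) /
      algebraMap Fq[X] (RatFunc Fq) x.1 ^ (2 * x.2 - 1))
    rw [← map_pow]
    exact ⟨_, Rep.div (c x) (pow_ne_zero _ (hc x hx).2.1.ne_zero) hp⟩

lemma pr_not_dvd {f N : Fq[X]} (hN : N.Monic)
    (hNf : ∀ P : Fq[X], P.Monic → Irreducible P → P ∣ N → ¬ P ∣ f)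
    {c : (Σ _ : Fq[X], ℕ) →₀ Fq[X]} (hc : c ∈ Dfin N) : ∀ P ∈ pr c, ¬ P ∣ f := by
  obtain ⟨h1, h2⟩ := (mem_Dfin hN.ne_zero c).1 hc
  intro P hP
  obtain ⟨hm, hi⟩ := h1.prime hP
  refine hNf P hm hi ?_
  have h3 : P ^ ex c P ∣ N := (Mc_dvd_iff h1 N).1 h2 ⟨P, ex c P⟩ (ex_mem hP)
  have h4 : 1 ≤ ex c P := (h1 ⟨P, ex c P⟩ (ex_mem hP)).2.2.1
  exact (dvd_pow_self P (by omega)).trans h3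

lemma chi_abs (z : ZMod 2) : |chi z| = 1 := by revert z; decide

lemma chi_eq (z : ZMod 2) : chi z = 1 ∨ chi z = -1 := by revert z; decide

lemma chi_eq_one {z : ZMod 2} (h : chi z = 1) : z = 0 := by revert z; decide

variable [CharP Fq 2]

lemma good_dvd {f g N : Fq[X]} (hf : f.Monic) (hfd : derivative f ≠ 0) (hg : derivative f = g ^ 2)
    (hN : N.Monic) (hNf : ∀ P : Fq[X], P.Monic → Irreducible P → P ∣ N → ¬ P ∣ f)
    (hgood : ∀ c ∈ Dfin N, quadSym (Phi c) f = 1) : N ∣ g := by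
  obtain ⟨tr, htr, htr0⟩ := exists_tr Fq
  apply dvd_of_pow_dvd hN
  intro P hP hPi i
  induction i with
  | zero => simp
  | succ i ih =>
    intro hd
    obtain ⟨g1, hg1⟩ := ih ((pow_dvd_pow P (Nat.le_succ i)).trans hd)
    have hPf : ¬ P ∣ f := hNf P hP hPi ((dvd_pow_self P (Nat.succ_ne_zero i)).trans hd)
    obtain ⟨p, hp⟩ := exists_inv hPi hPf (2 * i + 1)
    rw [hg1, pow_succ]
    apply mul_dvd_mul_left
    refine good_step hf hPi hfd (by rw [hg, hg1]) hp ?_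
    intro a ha
    by_contra hne
    obtain ⟨x, hx⟩ := htr0
    set k := x / lam f (a * p) with hk
    let c : (Σ _ : Fq[X], ℕ) →₀ Fq[X] := Finsupp.single ⟨P, i + 1⟩ (C k * a)
    have hsupp : ∀ y ∈ c.support, y = ⟨P, i + 1⟩ := by
      intro y hy
      have := Finsupp.support_single_subset hy
      simpa using this
    have hcD : DD c := by
      intro y hy
      have := hsupp y hy
      subst this
      refine ⟨hP, hPi, by simp, ?_⟩
      simp only [c, Finsupp.single_eq_same]
      exact lt_of_le_of_lt (by rw [← smul_eq_C_mul]; exact degree_smul_le _ _) ha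
    have hcm : c ∈ Dfin N := by
      rw [mem_Dfin hN.ne_zero, Mc_dvd_iff hcD]
      refine ⟨hcD, ?_⟩
      intro y hy
      have := hsupp y hy
      subst this
      exact hd
    have h1 := hgood c hcm
    have h2 : Phi c = algebraMap Fq[X] (RatFunc Fq) (C k * a) /
        algebraMap Fq[X] (RatFunc Fq) (P ^ (2 * i + 1)) := by
      unfold Phi
      rw [Finsupp.sum_single_index (by simp), map_pow]
      rfl
    rw [h2, (Rep.div (C k * a) (pow_ne_zero _ hPi.ne_zero) hp).quadSym htr ⟨x, hx⟩ hf] at h1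
    have h3 := chi_eq_one h1
    rw [mul_assoc, lam_C_mul, hk, div_mul_cancel₀ _ hne] at h3
    exact hx h3

lemma sum_bound {f g N : Fq[X]} (hf : f.Monic) (hfd : derivative f ≠ 0) (hg : derivative f = g ^ 2)
    (hN : N.Monic) (hNf : ∀ P : Fq[X], P.Monic → Irreducible P → P ∣ N → ¬ P ∣ f) :
    |∑ c ∈ Dfin N, quadSym (Phi c) f| ≤ if N ∣ g then (Fintype.card Fq : ℤ) ^ N.natDegree else 0 := by
  obtain ⟨tr, htr, htr0⟩ := exists_tr Fq
  have hrep : ∀ c ∈ Dfin N, ∃ k, Rep f k (Phi c) := fun c hc =>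
    exists_rep ((mem_Dfin hN.ne_zero c).1 hc).1 (pr_not_dvd hN hNf hc)
  split_ifs with hdvd
  · calc |∑ c ∈ Dfin N, quadSym (Phi c) f| ≤ ∑ c ∈ Dfin N, |quadSym (Phi c) f| :=
        Finset.abs_sum_le_sum_abs _ _
      _ = ∑ c ∈ Dfin N, 1 := by
        refine Finset.sum_congr rfl fun c hc => ?_
        obtain ⟨k, hk⟩ := hrep c hc
        rw [hk.quadSym htr htr0 hf, chi_abs]
      _ = (Fintype.card Fq : ℤ) ^ N.natDegree := by
        simp [card_Dfin hN]
      _ ≤ _ := le_rfl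
  · have : ∃ d ∈ Dfin N, quadSym (Phi d) f ≠ 1 := by
      by_contra! h
      exact hdvd (good_dvd hf hfd hg hN hNf h)
    obtain ⟨d, hd, hd1⟩ := this
    obtain ⟨kd, hkd⟩ := hrep d hd
    have hd2 : quadSym (Phi d) f = -1 := by
      rw [hkd.quadSym htr htr0 hf] at hd1 ⊢
      exact (chi_eq _).resolve_left hd1
    have hadd : ∀ c ∈ Dfin N, c + d ∈ Dfin N := by
      intro c hc
      unfold Dfin at *
      rw [Finset.mem_finsupp_iff] at *
      refine ⟨Finsupp.support_add.trans (Finset.union_subset hc.1 hd.1), fun x hx => ?_⟩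
      have h1 := hc.2 x hx
      have h2 := hd.2 x hx
      rw [mem_Lt] at *
      rw [Finsupp.add_apply]
      exact lt_of_le_of_lt (degree_add_le _ _) (max_lt h1 h2)
    have hdd : d + d = 0 := by
      ext x : 1
      rw [Finsupp.add_apply, Finsupp.zero_apply]
      exact CharTwo.add_self_eq_zero _
    have hinv : ∀ c, c + d + d = c := by
      intro c; rw [add_assoc, hdd, add_zero]
    have key : ∑ c ∈ Dfin N, quadSym (Phi c) f = ∑ c ∈ Dfin N, - quadSym (Phi c) f := by
      refine Finset.sum_nbij' (fun c => c + d) (fun c => c + d) hadd hadd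
        (fun c _ => hinv c) (fun c _ => hinv c) ?_
      intro c hc
      obtain ⟨k, hk⟩ := hrep c hc
      rw [Phi_add, (hk.add hkd).quadSym htr htr0 hf, lam_add, map_add, chi_add,
        ← hk.quadSym htr htr0 hf, ← hkd.quadSym htr htr0 hf, hd2]
      ring
    rw [Finset.sum_neg_distrib] at key
    have : ∑ c ∈ Dfin N, quadSym (Phi c) f = 0 := by omega
    rw [this]; simp

lemma sum_reduce {f N B : Fq[X]} (hN : N.Monic) (hB : B.Monic)
    (hBf : ∀ P : Fq[X], P.Monic → Irreducible P → P ∣ B → P ∣ f) :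
    ∑ c ∈ Dfin (N * B), quadSym (Phi c) f = ∑ c ∈ Dfin N, quadSym (Phi c) f := by
  symm
  have hNB := hN.mul hB
  refine Finset.sum_subset ?_ ?_
  · intro c hc
    rw [mem_Dfin hN.ne_zero] at hc
    rw [mem_Dfin hNB.ne_zero]
    exact ⟨hc.1, hc.2.mul_right _⟩
  · intro c hc hcN
    by_contra hne
    apply hcN
    rw [mem_Dfin hNB.ne_zero] at hc
    obtain ⟨hD, hd⟩ := hc
    rw [mem_Dfin hN.ne_zero]
    refine ⟨hD, ?_⟩
    rw [Mc_dvd_iff hD] at hd ⊢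
    have hcop : IsCoprime f (Phi c).denom := by
      by_contra h
      exact hne (by unfold quadSym; rw [if_neg h])
    intro x hx
    obtain ⟨h1, h2, -, -⟩ := hD x hx
    have h3 : x.1 ∣ (Phi c).denom := dvd_denom hD (Finset.mem_image_of_mem _ hx)
    have h4 : ¬ x.1 ∣ f := fun h => h2.not_isUnit (hcop.isUnit_of_dvd' h h3)
    have h5 : ¬ x.1 ∣ B := fun h => h4 (hBf _ h1 h2 h)
    have h6 : IsCoprime (x.1 ^ x.2) B := ((h2.coprime_iff_not_dvd).2 h5).pow_left
    exact h6.dvd_of_dvd_mul_right (hd x hx)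

end
end EvenChar

end

section
open scoped Classical
set_option linter.unusedSectionVars false
namespace EvenChar

section
variable {Fq : Type} [Field Fq] [Fintype Fq]

/-! ### Sums over smooth polynomials -/

lemma sum_pow_le (s : Finset Fq[X]) (E : Fq[X] → ℕ) (x : ℝ) (hx : 0 ≤ x) (Y : Finset Fq[X])
    (h : ∀ N ∈ Y, N.Monic ∧ (normalizedFactors N).toFinset ⊆ s ∧
      ∀ P ∈ s, (normalizedFactors N).count P ≤ E P) :
    ∑ N ∈ Y, x ^ N.natDegree ≤ ∏ P ∈ s, ∑ j ∈ Finset.range (E P + 1), x ^ (j * P.natDegree) := by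
  rw [Finset.prod_sum]
  let e : Fq[X] → ((P : Fq[X]) → P ∈ s → ℕ) := fun N P _ => (normalizedFactors N).count P
  have hinj : Set.InjOn e Y := by
    intro N hN N' hN' he
    rw [eq_prod_count (h N hN).1 s (h N hN).2.1, eq_prod_count (h N' hN').1 s (h N' hN').2.1]
    refine Finset.prod_congr rfl fun P hP => ?_
    have := congrFun (congrFun he P) hP
    simp only [e] at this
    rw [this]
  have h1 : ∑ N ∈ Y, x ^ N.natDegree =
      ∑ p ∈ Y.image e, ∏ P ∈ s.attach, x ^ (p P.1 P.2 * P.1.natDegree) := by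
    rw [Finset.sum_image hinj]
    refine Finset.sum_congr rfl fun N hN => ?_
    rw [natDegree_eq_sum (h N hN).1 s (h N hN).2.1, ← Finset.prod_pow_eq_pow_sum]
    exact (Finset.prod_attach s
      (fun P => x ^ ((normalizedFactors N).count P * P.natDegree))).symm
  rw [h1]
  refine Finset.sum_le_sum_of_subset_of_nonneg ?_ ?_
  · intro p hp
    obtain ⟨N, hN, rfl⟩ := Finset.mem_image.1 hp
    rw [Finset.mem_pi]
    intro P hP
    rw [Finset.mem_range]
    exact Nat.lt_succ_of_le ((h N hN).2.2 P hP)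
  · intro p _ _
    exact Finset.prod_nonneg fun P _ => pow_nonneg hx _

/-- weight -/
def wt (P : Fq[X]) : ℝ := if P.natDegree = 1 then 2 else 1

lemma wt_pos (P : Fq[X]) : 0 < wt P := by unfold wt; split_ifs <;> norm_num

lemma prod_wt (s : Finset Fq[X]) (hs : ∀ P ∈ s, P.Monic) :
    ∏ P ∈ s, wt P ≤ 2 ^ Fintype.card Fq := by
  unfold wt
  rw [← Finset.prod_filter, Finset.prod_const]
  refine pow_le_pow_right₀ (by norm_num) ?_
  have : (s.filter fun P => P.natDegree = 1) ⊆ Mon Fq 1 := by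
    intro P hP
    rw [Finset.mem_filter] at hP
    exact mem_Mon.2 ⟨hs P hP.1, hP.2⟩
  have := Finset.card_le_card this
  rwa [card_Mon, pow_one] at this

lemma geom_bound {y : ℝ} (h0 : 0 ≤ y) (h1 : y < 1) (n : ℕ) :
    ∑ j ∈ Finset.range n, y ^ j ≤ (1 - y)⁻¹ := by
  rw [← one_div, le_div_iff₀ (by linarith), geom_sum_mul_neg]
  linarith [pow_nonneg h0 n]

lemma local_rho {b : ℝ} (hb1 : 1 ≤ b) (hb : b ^ 4 = 2) {q : ℕ} (hq : 2 ≤ q) (P : Fq[X])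
    (hP : 1 ≤ P.natDegree) (n : ℕ) :
    ∑ j ∈ Finset.range (n + 1), ((q : ℝ)⁻¹) ^ (j * P.natDegree) ≤ wt P * b ^ P.natDegree := by
  have hq' : (2 : ℝ) ≤ q := by exact_mod_cast hq
  have hx0 : (0 : ℝ) ≤ (q : ℝ)⁻¹ := by positivity
  have hx : (q : ℝ)⁻¹ ≤ 1 / 2 := by
    rw [one_div]; exact inv_anti₀ (by norm_num) hq'
  have e : ∀ j : ℕ, ((q : ℝ)⁻¹) ^ (j * P.natDegree) = (((q : ℝ)⁻¹) ^ P.natDegree) ^ j := by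
    intro j; rw [mul_comm, pow_mul]
  simp only [e]
  set y := ((q : ℝ)⁻¹) ^ P.natDegree with hy
  have hy0 : 0 ≤ y := pow_nonneg hx0 _
  have hyb : y ≤ (1 / 2) ^ P.natDegree := pow_le_pow_left₀ hx0 hx _
  have hbd : 1 ≤ b ^ P.natDegree := one_le_pow₀ hb1
  unfold wt
  split_ifs with h
  · rw [h, pow_one] at hyb
    refine (geom_bound hy0 (by linarith) _).trans ?_
    have : (1 - y)⁻¹ ≤ 2 := by
      rw [inv_le_comm₀ (by linarith) (by norm_num)]; linarith
    nlinarith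
  · have h2 : (1 / 2 : ℝ) ^ P.natDegree ≤ (1 / 2) ^ 2 :=
      pow_le_pow_of_le_one (by norm_num) (by norm_num) (by omega)
    have h3 : y ≤ 1 / 4 := by linarith
    refine (geom_bound hy0 (by linarith) _).trans ?_
    have h4 : (1 - y)⁻¹ ≤ 4 / 3 := by
      rw [inv_le_comm₀ (by linarith) (by norm_num)]; linarith
    have h5 : b ^ 2 ≤ b ^ P.natDegree := pow_le_pow_right₀ hb1 (by omega)
    have h6 : 4 / 3 ≤ b ^ 2 := by nlinarith [sq_nonneg b]
    linarith

lemma local_tau {b : ℝ} (hb1 : 1 ≤ b) (hb : b ^ 4 = 2) (P : Fq[X])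
    (hP : 1 ≤ P.natDegree) (v : ℕ) :
    ∑ j ∈ Finset.range (v + 1), (1 : ℝ) ^ (j * P.natDegree) ≤
      wt P * (b ^ 2) ^ (v * P.natDegree) := by
  simp only [one_pow, Finset.sum_const, Finset.card_range, nsmul_eq_mul, mul_one]
  have h6 : 4 / 3 ≤ b ^ 2 := by nlinarith [sq_nonneg b]
  have h7 : (b ^ 2) ^ 2 = 2 := by rw [← pow_mul]; exact hb
  set c := b ^ 2
  push_cast
  unfold wt
  split_ifs with h
  · rw [h, mul_one]
    rcases Nat.lt_or_ge v 2 with hv | hv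
    · interval_cases v
      · norm_num
      · norm_num; linarith
    · induction v, hv using Nat.le_induction with
      | base => rw [h7]; norm_num
      | succ v hv ih =>
        have hv' : (2 : ℝ) ≤ v := by exact_mod_cast hv
        rw [pow_succ]
        push_cast
        nlinarith
  · have h8 : (c ^ 2) ^ v ≤ c ^ (v * P.natDegree) := by
      rw [← pow_mul]
      apply pow_le_pow_right₀ (by linarith)
      rw [mul_comm]
      exact Nat.mul_le_mul_left _ (by omega)
    rw [h7] at h8
    have h9 : ((v + 1 : ℕ) : ℝ) ≤ 2 ^ v := by
      exact_mod_cast Nat.lt_two_pow_self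
    push_cast at h9
    linarith

lemma nf_spec {N P : Fq[X]} (h : P ∈ (normalizedFactors N).toFinset) :
    P.Monic ∧ Irreducible P ∧ 1 ≤ P.natDegree := by
  rw [Multiset.mem_toFinset] at h
  have := irreducible_of_normalized_factor P h
  exact ⟨monic_of_mem_nf h, this, this.natDegree_pos⟩

lemma rho_bound {b : ℝ} (hb1 : 1 ≤ b) (hb : b ^ 4 = 2) {f : Fq[X]} (hf : f.Monic)
    (n : ℕ) (Y : Finset Fq[X]) (hY : ∀ B ∈ Y, B.Monic ∧ B.natDegree ≤ n ∧
      ∀ P : Fq[X], P.Monic → Irreducible P → P ∣ B → P ∣ f) :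
    ∑ B ∈ Y, ((Fintype.card Fq : ℝ)⁻¹) ^ B.natDegree ≤
      2 ^ Fintype.card Fq * b ^ f.natDegree := by
  set s := (normalizedFactors f).toFinset with hs
  have hq : 2 ≤ Fintype.card Fq := Fintype.one_lt_card
  have h1 : ∀ B ∈ Y, B.Monic ∧ (normalizedFactors B).toFinset ⊆ s ∧
      ∀ P ∈ s, (normalizedFactors B).count P ≤ n := by
    intro B hB
    obtain ⟨hm, hd, hp⟩ := hY B hB
    refine ⟨hm, ?_, ?_⟩
    · intro P hP
      rw [Multiset.mem_toFinset, mem_nf_iff hm.ne_zero] at hP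
      rw [hs, Multiset.mem_toFinset, mem_nf_iff hf.ne_zero]
      exact ⟨hP.1, hP.2.1, hp P hP.1 hP.2.1 hP.2.2⟩
    · intro P hP
      obtain ⟨a1, a2, a3⟩ := nf_spec hP
      have h2 : P ^ (normalizedFactors B).count P ∣ B :=
        (pow_dvd_iff_le_count a1 a2 hm.ne_zero _).2 le_rfl
      have h3 := natDegree_le_of_dvd h2 hm.ne_zero
      rw [natDegree_pow] at h3
      have : (normalizedFactors B).count P * 1 ≤ (normalizedFactors B).count P * P.natDegree :=
        Nat.mul_le_mul_left _ a3
      omega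
  refine (sum_pow_le s (fun _ => n) _ (by positivity) Y h1).trans ?_
  calc _ ≤ ∏ P ∈ s, wt P * b ^ P.natDegree := by
        refine Finset.prod_le_prod (fun P _ => Finset.sum_nonneg fun _ _ => by positivity) ?_
        intro P hP
        exact local_rho hb1 hb hq P (nf_spec hP).2.2 n
    _ = (∏ P ∈ s, wt P) * b ^ (∑ P ∈ s, P.natDegree) := by
        rw [Finset.prod_mul_distrib, Finset.prod_pow_eq_pow_sum]
    _ ≤ _ := by
        refine mul_le_mul (prod_wt s fun P hP => (nf_spec hP).1) ?_ (by positivity) (by positivity)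
        refine pow_le_pow_right₀ hb1 ?_
        rw [natDegree_eq_sum hf s (Finset.Subset.refl _)]
        refine Finset.sum_le_sum fun P hP => ?_
        have : 1 ≤ (normalizedFactors f).count P :=
          Multiset.count_pos.2 (Multiset.mem_toFinset.1 hP)
        exact Nat.le_mul_of_pos_left _ this

lemma tau_bound {b : ℝ} (hb1 : 1 ≤ b) (hb : b ^ 4 = 2) {g : Fq[X]} (hg : g.Monic)
    (Y : Finset Fq[X]) (hY : ∀ N ∈ Y, N.Monic ∧ N ∣ g) :
    ∑ N ∈ Y, (1 : ℝ) ^ N.natDegree ≤ 2 ^ Fintype.card Fq * (b ^ 2) ^ g.natDegree := by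
  set s := (normalizedFactors g).toFinset with hs
  have h1 : ∀ N ∈ Y, N.Monic ∧ (normalizedFactors N).toFinset ⊆ s ∧
      ∀ P ∈ s, (normalizedFactors N).count P ≤ (normalizedFactors g).count P := by
    intro N hN
    obtain ⟨hm, hd⟩ := hY N hN
    have := (dvd_iff_normalizedFactors_le_normalizedFactors hm.ne_zero hg.ne_zero).1 hd
    exact ⟨hm, Multiset.toFinset_subset.2 (Multiset.subset_of_le this),
      fun P _ => Multiset.le_iff_count.1 this P⟩
  refine (sum_pow_le s (fun P => (normalizedFactors g).count P) _ (by positivity) Y h1).trans ?_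
  calc _ ≤ ∏ P ∈ s, wt P * (b ^ 2) ^ ((normalizedFactors g).count P * P.natDegree) := by
        refine Finset.prod_le_prod (fun P _ => Finset.sum_nonneg fun _ _ => by positivity) ?_
        intro P hP
        exact local_tau hb1 hb P (nf_spec hP).2.2 _
    _ = (∏ P ∈ s, wt P) * (b ^ 2) ^ g.natDegree := by
        rw [Finset.prod_mul_distrib, Finset.prod_pow_eq_pow_sum,
          ← natDegree_eq_sum hg s (Finset.Subset.refl _)]
    _ ≤ _ := by
        refine mul_le_mul_of_nonneg_right (prod_wt s fun P hP => (nf_spec hP).1) (by positivity)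

/-! ### The sums `S` and `T` -/

/-- all data with modulus of degree at most `n` -/
def UU (Fq : Type) [Field Fq] [Fintype Fq] (n : ℕ) : Finset ((Σ _ : Fq[X], ℕ) →₀ Fq[X]) :=
  (Finset.range (n + 1)).biUnion fun k => (Mon Fq k).biUnion Dfin

lemma mem_UU {n : ℕ} {c : (Σ _ : Fq[X], ℕ) →₀ Fq[X]} :
    c ∈ UU Fq n ↔ DD c ∧ (Mc c).natDegree ≤ n := by
  unfold UU
  simp only [Finset.mem_biUnion, Finset.mem_range, mem_Mon]
  constructor
  · rintro ⟨k, hk, M, ⟨hM, hMk⟩, hc⟩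
    rw [mem_Dfin hM.ne_zero] at hc
    have := natDegree_le_of_dvd hc.2 hM.ne_zero
    exact ⟨hc.1, by omega⟩
  · rintro ⟨hc, hd⟩
    exact ⟨_, Nat.lt_succ_of_le hd, Mc c, ⟨Mc_monic hc, rfl⟩,
      (mem_Dfin (Mc_monic hc).ne_zero c).2 ⟨hc, dvd_rfl⟩⟩

/-- the sum over all moduli of degree `m` -/
def SS (f : Fq[X]) (m : ℕ) : ℤ := ∑ M ∈ Mon Fq m, ∑ c ∈ Dfin M, quadSym (Phi c) f

lemma SS_eq (f : Fq[X]) {m n : ℕ} (hmn : m ≤ n) :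
    SS f m = ∑ c ∈ UU Fq n, quadSym (Phi c) f *
      (if (Mc c).natDegree ≤ m then (Fintype.card Fq : ℤ) ^ (m - (Mc c).natDegree) else 0) := by
  unfold SS
  have h1 : ∀ M ∈ Mon Fq m, ∑ c ∈ Dfin M, quadSym (Phi c) f =
      ∑ c ∈ UU Fq n, if Mc c ∣ M then quadSym (Phi c) f else 0 := by
    intro M hM
    rw [mem_Mon] at hM
    rw [← Finset.sum_filter]
    refine Finset.sum_congr ?_ fun _ _ => rfl
    ext c
    rw [Finset.mem_filter, mem_UU, mem_Dfin hM.1.ne_zero]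
    constructor
    · rintro ⟨h1, h2⟩
      have := natDegree_le_of_dvd h2 hM.1.ne_zero
      exact ⟨⟨h1, by omega⟩, h2⟩
    · rintro ⟨⟨h1, -⟩, h2⟩
      exact ⟨h1, h2⟩
  rw [Finset.sum_congr rfl h1, Finset.sum_comm]
  refine Finset.sum_congr rfl fun c hc => ?_
  rw [← Finset.sum_filter, Finset.sum_const, card_Mon_dvd (Mc_monic (mem_UU.1 hc).1), nsmul_eq_mul,
    mul_comm]
  split_ifs <;> simp

lemma T_eq (f : Fq[X]) {n : ℕ} (hn : 1 ≤ n) :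
    ∑ c ∈ (UU Fq n).filter (fun c => (Mc c).natDegree = n), quadSym (Phi c) f =
      SS f n - Fintype.card Fq * SS f (n - 1) := by
  rw [SS_eq f le_rfl, SS_eq f (Nat.sub_le n 1), Finset.mul_sum, ← Finset.sum_sub_distrib,
    Finset.sum_filter]
  refine Finset.sum_congr rfl fun c hc => ?_
  have hd := (mem_UU.1 hc).2
  rw [if_pos hd]
  split_ifs with h1 h2 h2
  · omega
  · rw [h1]; simp
  · have : n - (Mc c).natDegree = (n - 1 - (Mc c).natDegree) + 1 := by omega
    rw [this, pow_succ]; ring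
  · omega

lemma tsum_eq (f : Fq[X]) (n : ℕ) :
    ∑' u : (Ffam Fq n : Set (RatFunc Fq)), (quadSym u.1 f : ℝ) =
      ((∑ c ∈ (UU Fq n).filter (fun c => (Mc c).natDegree = n), quadSym (Phi c) f : ℤ) : ℝ) := by
  have h : Ffam Fq n =
      (((UU Fq n).filter (fun c => (Mc c).natDegree = n)).image Phi : Finset (RatFunc Fq)) := by
    rw [Ffam_eq, Finset.coe_image]
    congr 1
    ext c
    simp only [Set.mem_setOf_eq, Finset.coe_filter, mem_UU]
    constructor
    · rintro ⟨h1, h2⟩; exact ⟨⟨h1, h2.le⟩, h2⟩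
    · rintro ⟨⟨h1, -⟩, h2⟩; exact ⟨h1, h2⟩
  rw [h, Finset.tsum_subtype' _ (fun u => (quadSym u f : ℝ)), Finset.sum_image]
  · push_cast; rfl
  · intro c hc d hd
    have hc' := (mem_UU.1 (Finset.mem_filter.1 hc).1).1
    have hd' := (mem_UU.1 (Finset.mem_filter.1 hd).1).1
    exact Phi_injOn hc' hd'

variable [CharP Fq 2]

lemma SS_bound {b : ℝ} (hb1 : 1 ≤ b) (hb : b ^ 4 = 2) {f g : Fq[X]} (hf : f.Monic)
    (hfd : derivative f ≠ 0) (hg : derivative f = g ^ 2) (m : ℕ) :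
    |(SS f m : ℝ)| ≤ (Fintype.card Fq : ℝ) ^ m *
      ((2 ^ Fintype.card Fq * (b ^ 2) ^ g.natDegree) *
        (2 ^ Fintype.card Fq * b ^ f.natDegree)) := by
  have hg0 : g ≠ 0 := by
    rintro rfl
    exact hfd (by simpa using hg)
  have hq0 : (Fintype.card Fq : ℝ) ≠ 0 := by
    exact_mod_cast Fintype.card_ne_zero
  have hdec : ∀ M : Fq[X], ∃ N B : Fq[X], M.Monic → (N.Monic ∧ B.Monic ∧ M = N * B ∧
      (∀ P : Fq[X], P.Monic → Irreducible P → P ∣ N → ¬ P ∣ f) ∧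
      (∀ P : Fq[X], P.Monic → Irreducible P → P ∣ B → P ∣ f)) := by
    intro M
    by_cases hM : M.Monic
    · obtain ⟨N, B, h⟩ := exists_decomp f hM
      exact ⟨N, B, fun _ => h⟩
    · exact ⟨0, 0, fun h => absurd h hM⟩
  choose N B hNB using hdec
  set R := (Mon Fq m).filter fun M => N M ∣ g with hR
  have hmon : ∀ M ∈ R, M.Monic ∧ M.natDegree = m ∧ N M ∣ g := by
    intro M hM
    rw [hR, Finset.mem_filter, mem_Mon] at hM
    exact ⟨hM.1.1, hM.1.2, hM.2⟩
  have h1 : |SS f m| ≤ ∑ M ∈ R, (Fintype.card Fq : ℤ) ^ (N M).natDegree := by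
    rw [hR, Finset.sum_filter]
    refine (Finset.abs_sum_le_sum_abs _ _).trans (Finset.sum_le_sum fun M hM => ?_)
    obtain ⟨a1, a2, a3, a4, a5⟩ := hNB M (mem_Mon.1 hM).1
    have e : ∑ c ∈ Dfin M, quadSym (Phi c) f = ∑ c ∈ Dfin (N M), quadSym (Phi c) f := by
      conv_lhs => rw [a3]
      exact sum_reduce a1 a2 a5
    rw [e]
    exact sum_bound hf hfd hg a1 a4
  have h2 : |(SS f m : ℝ)| ≤ ∑ M ∈ R, (Fintype.card Fq : ℝ) ^ (N M).natDegree := by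
    exact_mod_cast h1
  refine h2.trans ?_
  have h3 : ∀ M ∈ R, (Fintype.card Fq : ℝ) ^ (N M).natDegree = (Fintype.card Fq : ℝ) ^ m *
      ((1 : ℝ) ^ (N M).natDegree * ((Fintype.card Fq : ℝ)⁻¹) ^ (B M).natDegree) := by
    intro M hM
    obtain ⟨b1, b2, b3⟩ := hmon M hM
    obtain ⟨a1, a2, a3, a4, a5⟩ := hNB M b1
    have : m = (N M).natDegree + (B M).natDegree := by
      rw [← a1.natDegree_mul a2, ← a3, b2]
    rw [this, pow_add, one_pow, one_mul, mul_assoc, ← mul_pow, mul_inv_cancel₀ hq0, one_pow, mul_one]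
  rw [Finset.sum_congr rfl h3, ← Finset.mul_sum]
  refine mul_le_mul_of_nonneg_left ?_ (by positivity)
  have h4 : ∑ M ∈ R, ((1 : ℝ) ^ (N M).natDegree * ((Fintype.card Fq : ℝ)⁻¹) ^ (B M).natDegree) ≤
      (∑ K ∈ R.image N, (1 : ℝ) ^ K.natDegree) *
        (∑ K ∈ R.image B, ((Fintype.card Fq : ℝ)⁻¹) ^ K.natDegree) := by
    rw [Finset.sum_mul_sum, ← Finset.sum_product']
    have hinj : Set.InjOn (fun M => (N M, B M)) (R : Set Fq[X]) := by
      intro M hM M' hM' he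
      obtain ⟨-, -, a3, -⟩ := hNB M (hmon M hM).1
      obtain ⟨-, -, b3, -⟩ := hNB M' (hmon M' hM').1
      simp only [Prod.mk.injEq] at he
      rw [a3, b3, he.1, he.2]
    rw [← Finset.sum_image (f := fun x : Fq[X] × Fq[X] =>
      (1 : ℝ) ^ x.1.natDegree * ((Fintype.card Fq : ℝ)⁻¹) ^ x.2.natDegree) hinj]
    refine Finset.sum_le_sum_of_subset_of_nonneg ?_ fun _ _ _ => by positivity
    intro x hx
    obtain ⟨M, hM, rfl⟩ := Finset.mem_image.1 hx
    exact Finset.mem_product.2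
      ⟨Finset.mem_image_of_mem _ hM, Finset.mem_image_of_mem _ hM⟩
  refine h4.trans (mul_le_mul ?_ ?_ (Finset.sum_nonneg fun _ _ => by positivity) (by positivity))
  · have hgm : (normalize g).Monic := monic_normalize hg0
    have hgd : (normalize g).natDegree = g.natDegree :=
      natDegree_eq_of_degree_eq degree_normalize
    rw [← hgd]
    refine tau_bound hb1 hb hgm _ ?_
    intro K hK
    obtain ⟨M, hM, rfl⟩ := Finset.mem_image.1 hK
    exact ⟨(hNB M (hmon M hM).1).1, dvd_normalize_iff.2 (hmon M hM).2.2⟩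
  · refine rho_bound hb1 hb hf m _ ?_
    intro K hK
    obtain ⟨M, hM, rfl⟩ := Finset.mem_image.1 hK
    obtain ⟨b1, b2, b3⟩ := hmon M hM
    obtain ⟨a1, a2, a3, a4, a5⟩ := hNB M b1
    refine ⟨a2, ?_, a5⟩
    have : M.natDegree = (N M).natDegree + (B M).natDegree := by
      rw [← a1.natDegree_mul a2, ← a3]
    omega

lemma T_bound {n : ℕ} (hn : 1 ≤ n) {f : Fq[X]} (hf : f.Monic)
    (hns : ¬ ∃ r : Fq[X], f = r ^ 2) :
    |∑' u : (Ffam Fq n : Set (RatFunc Fq)), (quadSym u.1 f : ℝ)| ≤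
        (2 * 4 ^ Fintype.card Fq) * (2 : ℝ) ^ ((f.natDegree : ℝ) / 2) *
          (Fintype.card Fq : ℝ) ^ n := by
  have hfd : derivative f ≠ 0 := fun h => hns (exists_sq_of_derivative_eq_zero f h)
  obtain ⟨g, hg⟩ := exists_sq_of_derivative_eq_zero (derivative f) (derivative_derivative_eq_zero f)
  have hgd : 2 * g.natDegree ≤ f.natDegree := by
    have := natDegree_derivative_le f
    rw [hg, natDegree_pow] at this
    omega
  set b : ℝ := (2 : ℝ) ^ (1 / 4 : ℝ) with hbdef
  have hb1 : 1 ≤ b := Real.one_le_rpow (by norm_num) (by norm_num)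
  have hb : b ^ 4 = 2 := by
    rw [hbdef, ← Real.rpow_natCast, ← Real.rpow_mul (by norm_num)]
    norm_num
  have hb2 : (2 : ℝ) ^ ((f.natDegree : ℝ) / 2) = b ^ f.natDegree * b ^ f.natDegree := by
    rw [← pow_add, hbdef, ← Real.rpow_natCast, ← Real.rpow_mul (by norm_num)]
    congr 1
    push_cast
    ring
  have hq0 : (0 : ℝ) ≤ Fintype.card Fq := by positivity
  set q : ℝ := (Fintype.card Fq : ℝ) with hq
  set K : ℝ := (2 ^ Fintype.card Fq * (b ^ 2) ^ g.natDegree) *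
        (2 ^ Fintype.card Fq * b ^ f.natDegree) with hK
  have h1 : |(SS f n : ℝ)| ≤ q ^ n * K := SS_bound hb1 hb hf hfd hg n
  have h2 : |(SS f (n - 1) : ℝ)| ≤ q ^ (n - 1) * K := SS_bound hb1 hb hf hfd hg (n - 1)
  have h3 : K ≤ 4 ^ Fintype.card Fq * (b ^ f.natDegree * b ^ f.natDegree) := by
    have e : (4 : ℝ) ^ Fintype.card Fq = 2 ^ Fintype.card Fq * 2 ^ Fintype.card Fq := by
      rw [← mul_pow]; norm_num
    have h4 : (b ^ 2) ^ g.natDegree ≤ b ^ f.natDegree := by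
      rw [← pow_mul]
      exact pow_le_pow_right₀ hb1 hgd
    calc K ≤ (2 ^ Fintype.card Fq * b ^ f.natDegree) * (2 ^ Fintype.card Fq * b ^ f.natDegree) := by
          rw [hK]; gcongr
      _ = _ := by rw [e]; ring
  rw [tsum_eq, T_eq f hn, hb2]
  push_cast
  have h5 : q * q ^ (n - 1) = q ^ n := by
    rw [← pow_succ', Nat.sub_add_cancel hn]
  calc |(SS f n : ℝ) - q * (SS f (n - 1) : ℝ)| ≤ |(SS f n : ℝ)| + |q * (SS f (n - 1) : ℝ)| :=
        abs_sub _ _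
    _ = |(SS f n : ℝ)| + q * |(SS f (n - 1) : ℝ)| := by rw [abs_mul, abs_of_nonneg hq0]
    _ ≤ q ^ n * K + q * (q ^ (n - 1) * K) := by gcongr
    _ = 2 * q ^ n * K := by linear_combination K * h5
    _ ≤ 2 * q ^ n * (4 ^ Fintype.card Fq * (b ^ f.natDegree * b ^ f.natDegree)) := by gcongr
    _ = _ := by ring

end
end EvenChar

end

namespace EvenChar

theorem statement18 {Fq : Type} [Field Fq] [Fintype Fq] (hchar : ringChar Fq = 2) :
    ∃ C : ℝ, 0 < C ∧ ∀ n : ℕ, 1 ≤ n → ∀ f : Polynomial Fq, f.Monic →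
      (¬ ∃ r : Polynomial Fq, f = r ^ 2) →
      |∑' u : (Ffam Fq n : Set (RatFunc Fq)), (quadSym u.1 f : ℝ)| ≤
        C * (2 : ℝ) ^ ((f.natDegree : ℝ) / 2) * (Fintype.card Fq : ℝ) ^ n := by
  haveI : CharP Fq 2 := hchar ▸ ringChar.charP Fq
  refine ⟨2 * 4 ^ Fintype.card Fq, by positivity, ?_⟩
  intro n hn f hf hns
  exact T_bound hn hf hns

end EvenChar
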